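/- arXiv:2302.00118 — 2 statements merged into one kernel-verified Lean document; each statement's English description precedes it below -/
import Mathlib

section
/- Let p_{XY}, p_{XZ}, p_{YZ} : {−1,1} × {−1,1} → ℝ be nonnegative functions each summing to 1, which are no-signal consistent. Then there exists a function μ : {−1,1}³ → ℝ with Σ_{(x,y,z)} μ(x,y,z) = 1 whose three pairwise marginals reproduce the given distributions: Σ_z μ(x,y,z) = p_{XY}(x,y) for all (x,y), Σ_y μ(x,y,z) = p_{XZ}(x,z) for all (x,z), and Σ_x μ(x,y,z) = p_{YZ}(y,z) for all (y,z). (μ may take negative values.) -/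
/-- The two-point outcome set `{-1, 1}`. -/
abbrev PM : Type := ({-1, 1} : Finset ℤ)

theorem PM_sum (f : PM → ℝ) : ∑ x : PM, f x = f ⟨-1, by simp⟩ + f ⟨1, by simp⟩ := by
  have h : (Finset.univ : Finset PM) = {⟨-1, by simp⟩, ⟨1, by simp⟩} := by decide
  rw [h, Finset.sum_pair (by decide)]

theorem PM_cases (x : PM) : x = ⟨-1, by simp⟩ ∨ x = ⟨1, by simp⟩ := by
  revert x; decide

/-- Given pairwise joint distributions `p_{XY}, p_{XZ}, p_{YZ}` on `{-1,1} × {-1,1}`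
(nonnegative, each summing to one) that are no-signal consistent, there exists a
(possibly signed) global distribution `μ` on `{-1,1}³`, summing to one, whose three
pairwise marginals reproduce the given distributions. -/
theorem stmt_7 (pXY pXZ pYZ : PM → PM → ℝ)
    (hXY0 : ∀ x y, 0 ≤ pXY x y) (hXZ0 : ∀ x z, 0 ≤ pXZ x z) (hYZ0 : ∀ y z, 0 ≤ pYZ y z)
    (hXY1 : ∑ x : PM, ∑ y : PM, pXY x y = 1)
    (hXZ1 : ∑ x : PM, ∑ z : PM, pXZ x z = 1)
    (hYZ1 : ∑ y : PM, ∑ z : PM, pYZ y z = 1)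
    (hX : ∀ x, ∑ y : PM, pXY x y = ∑ z : PM, pXZ x z)
    (hY : ∀ y, ∑ x : PM, pXY x y = ∑ z : PM, pYZ y z)
    (hZ : ∀ z, ∑ x : PM, pXZ x z = ∑ y : PM, pYZ y z) :
    ∃ μ : PM → PM → PM → ℝ,
      (∑ x : PM, ∑ y : PM, ∑ z : PM, μ x y z = 1) ∧
      (∀ x y, ∑ z : PM, μ x y z = pXY x y) ∧
      (∀ x z, ∑ y : PM, μ x y z = pXZ x z) ∧
      (∀ y z, ∑ x : PM, μ x y z = pYZ y z) := by
  simp only [PM_sum] at *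
  generalize_proofs ha hb at *
  have hXa := hX ⟨-1, ha⟩
  have hXb := hX ⟨1, hb⟩
  have hYa := hY ⟨-1, ha⟩
  have hYb := hY ⟨1, hb⟩
  have hZa := hZ ⟨-1, ha⟩
  have hZb := hZ ⟨1, hb⟩
  -- Fourier-type inclusion-exclusion formula with vanishing triple correlation
  refine ⟨fun x y z => (pXY x y + pXZ x z + pYZ y z) / 2
    - (pXY x ⟨-1, ha⟩ + pXY x ⟨1, hb⟩) / 4
    - (pXY ⟨-1, ha⟩ y + pXY ⟨1, hb⟩ y) / 4
    - (pXZ ⟨-1, ha⟩ z + pXZ ⟨1, hb⟩ z) / 4 + 1 / 8, ?_, ?_, ?_, ?_⟩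
  · linarith
  all_goals
    intro u v
    rcases PM_cases u with rfl | rfl <;> rcases PM_cases v with rfl | rfl <;> linarith
end

section
/- Fix ℏ > 0 and let ψ, φ : ℝ → ℂ be Schwartz functions. Then the Moyal overlap formula holds: |∫_ℝ conj(ψ(x)) φ(x) dx|² = 2πℏ ∫_ℝ ∫_ℝ W_ψ(q, p) W_φ(q, p) dq dp. -/
open MeasureTheory

/-- The Wigner function of `ψ : ℝ → ℂ` (with Planck constant `h`):
`W_ψ(q,p) = (1/(2π)) ∫ conj(ψ(q + h s/2)) ψ(q − h s/2) e^{i p s} ds`. -/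
noncomputable def wigner (h : ℝ) (ψ : ℝ → ℂ) (q p : ℝ) : ℂ :=
  (1 / (2 * Real.pi) : ℂ) *
    ∫ s : ℝ, (starRingEnd ℂ) (ψ (q + h * s / 2)) * ψ (q - h * s / 2) *
      Complex.exp (Complex.I * (p : ℂ) * (s : ℂ))

lemma moyal_int1 (a b d c : ℝ → ℂ) (ha : Integrable a) (hb : Integrable b) (hd : Integrable d)
    (hac : Continuous a) (hbc : Continuous b) (hdc : Continuous d) (hcc : Continuous c)
    (M : ℝ) (hM : ∀ x, ‖c x‖ ≤ M) :
    Integrable (fun w : ℝ × (ℝ × ℝ) =>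
      (a w.2.1 * b (w.1 - w.2.1)) * (d w.2.2 * c (w.1 - w.2.2)))
      (volume.prod (volume.prod volume)) := by
  have hg : Integrable (fun w : ℝ × (ℝ × ℝ) =>
      (‖a w.2.1‖ * ‖d w.2.2‖ * M) * ‖b (w.1 - w.2.1)‖) (volume.prod (volume.prod volume)) := by
    have hM0 : 0 ≤ M := (norm_nonneg _).trans (hM 0)
    rw [integrable_prod_iff' (by apply Continuous.aestronglyMeasurable; fun_prop)]
    constructor
    · exact Filter.Eventually.of_forall fun w =>
        ((hb.comp_sub_right w.1).norm).const_mul (‖a w.1‖ * ‖d w.2‖ * M)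
    · have : ∀ w : ℝ × ℝ, ∫ r : ℝ, ‖(‖a w.1‖ * ‖d w.2‖ * M) * ‖b (r - w.1)‖‖
          = (‖a w.1‖ * ‖d w.2‖) * (M * ∫ r, ‖b r‖) := by
        intro w
        simp only [norm_mul, norm_norm, Real.norm_of_nonneg hM0]
        rw [integral_const_mul, integral_sub_right_eq_self (fun r => ‖b r‖) w.1]
        ring
      simp only [this]
      exact (ha.norm.mul_prod hd.norm).mul_const _
  refine hg.mono' (by apply Continuous.aestronglyMeasurable; fun_prop) ?_
  refine Filter.Eventually.of_forall fun w => ?_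
  simp only [norm_mul]
  calc _ = (‖a w.2.1‖ * ‖d w.2.2‖ * ‖c (w.1 - w.2.2)‖) * ‖b (w.1 - w.2.1)‖ := by ring
    _ ≤ _ := by gcongr; exact hM _

lemma moyal_int2 (a d D : ℝ → ℂ) (ha : Integrable a) (hd : Integrable d)
    (hac : Continuous a) (hdc : Continuous d) (hDc : Continuous D)
    (M : ℝ) (hM : ∀ x, ‖D x‖ ≤ M) :
    Integrable (fun w : ℝ × ℝ => (a w.1 * d (w.1 - w.2)) * D w.2) (volume.prod volume) := by
  have hg : Integrable (fun w : ℝ × ℝ => (‖a w.1‖ * M) * ‖d (w.1 - w.2)‖)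
      (volume.prod volume) := by
    have hM0 : 0 ≤ M := (norm_nonneg _).trans (hM 0)
    rw [integrable_prod_iff (by apply Continuous.aestronglyMeasurable; fun_prop)]
    constructor
    · exact Filter.Eventually.of_forall fun x =>
        ((hd.comp_sub_left x).norm).const_mul (‖a x‖ * M)
    · have : ∀ x : ℝ, ∫ v : ℝ, ‖(‖a x‖ * M) * ‖d (x - v)‖‖
          = ‖a x‖ * (M * ∫ r, ‖d r‖) := by
        intro x
        simp only [norm_mul, norm_norm, Real.norm_of_nonneg hM0]
        rw [integral_const_mul, integral_sub_left_eq_self (fun r => ‖d r‖) volume x]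
        ring
      simp only [this]
      exact ha.norm.mul_const _
  refine hg.mono' (by apply Continuous.aestronglyMeasurable; fun_prop) ?_
  refine Filter.Eventually.of_forall fun w => ?_
  simp only [norm_mul]
  calc _ = (‖a w.1‖ * ‖D w.2‖) * ‖d (w.1 - w.2)‖ := by ring
    _ ≤ _ := by gcongr; exact hM _

lemma moyal_fubini (a b d c D : ℝ → ℂ) (ha : Integrable a) (hb : Integrable b) (hd : Integrable d)
    (hac : Continuous a) (hbc : Continuous b) (hdc : Continuous d) (hcc : Continuous c)
    (M : ℝ) (hM : ∀ x, ‖c x‖ ≤ M) (hDc : Continuous D) (M' : ℝ) (hM' : ∀ x, ‖D x‖ ≤ M')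
    (hD : ∀ v, D v = ∫ y, b y * c (y + v)) :
    ∫ r, (∫ x, a x * b (r - x)) * (∫ z, d z * c (r - z))
      = ∫ v, (∫ x, a x * d (x - v)) * D v := by
  have h1 : ∀ r, (∫ x, a x * b (r - x)) * (∫ z, d z * c (r - z))
      = ∫ w : ℝ × ℝ, (a w.1 * b (r - w.1)) * (d w.2 * c (r - w.2)) ∂(volume.prod volume) := by
    intro r
    rw [← integral_prod_mul (fun x => a x * b (r - x)) (fun z => d z * c (r - z))]
  simp only [h1]
  have hi := moyal_int1 a b d c ha hb hd hac hbc hdc hcc M hM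
  rw [integral_integral_swap hi]
  have h2 : ∀ w : ℝ × ℝ, ∫ r, (a w.1 * b (r - w.1)) * (d w.2 * c (r - w.2))
      = a w.1 * d w.2 * D (w.1 - w.2) := by
    intro w
    rw [hD, ← integral_const_mul,
      ← integral_sub_right_eq_self (fun y => a w.1 * d w.2 * (b y * c (y + (w.1 - w.2)))) w.1]
    congr 1; ext r
    rw [show r - w.1 + (w.1 - w.2) = r - w.2 by ring]
    ring
  have hi2 := hi.integral_prod_right
  simp only [h2] at hi2 ⊢
  rw [integral_prod _ hi2]
  have h3 : ∀ x, ∫ z, a x * d z * D (x - z) = ∫ v, a x * d (x - v) * D v := by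
    intro x
    rw [← integral_sub_left_eq_self (fun z => a x * d z * D (x - z)) volume x]
    simp
  simp only [h3]
  rw [integral_integral_swap (moyal_int2 a d D ha hd hac hdc hDc M' hM')]
  congr 1; ext v
  rw [integral_mul_const]

open FourierTransform in
lemma moyal_inv (E : SchwartzMap ℝ ℂ) : ∫ w, (𝓕⁻ E) w = E 0 := by
  have h : 𝓕 (𝓕⁻ E) = E := by simp
  have h2 : (𝓕 (𝓕⁻ E)) 0 = ∫ w, (𝓕⁻ E) w := by
    rw [SchwartzMap.fourier_coe, Real.fourier_eq']
    simp
  rw [← h2, h]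

open FourierTransform in
lemma moyal_inv' (E : SchwartzMap ℝ ℂ) (k : ℝ) (hk : 0 < k) :
    ∫ p : ℝ, ∫ v : ℝ, Complex.exp (Complex.I * (p * v * 2 / k : ℝ)) * E v
      = (Real.pi * k : ℝ) * E 0 := by
  have h : ∀ p : ℝ, ∫ v : ℝ, Complex.exp (Complex.I * (p * v * 2 / k : ℝ)) * E v
      = (𝓕⁻ E) ((Real.pi * k)⁻¹ * p) := by
    intro p
    rw [SchwartzMap.fourierInv_coe, Real.fourierInv_eq']
    congr 1; ext v
    rw [smul_eq_mul]
    congr 2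
    have := Real.pi_pos.ne'
    simp only [RCLike.inner_apply, conj_trivial]
    rw [mul_comm]
    congr 2
    field_simp
  simp only [h]
  have h5 := Measure.integral_comp_mul_left (fun w => (𝓕⁻ E) w) (Real.pi * k)⁻¹
  rw [h5, moyal_inv, inv_inv,
    abs_of_pos (by positivity), Complex.real_smul]

/-- conjugate Schwartz function -/
noncomputable def moyalConj (f : SchwartzMap ℝ ℂ) : SchwartzMap ℝ ℂ :=
  SchwartzMap.postcompCLM (𝕜 := ℝ) (Complex.conjCLE : ℂ →L[ℝ] ℂ) f

noncomputable def moyalRefl (f : SchwartzMap ℝ ℂ) : SchwartzMap ℝ ℂ :=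
  SchwartzMap.compCLMOfContinuousLinearEquiv ℝ (ContinuousLinearEquiv.neg ℝ) f

lemma moyalConj_apply (f : SchwartzMap ℝ ℂ) (x : ℝ) :
    moyalConj f x = (starRingEnd ℂ) (f x) := by simp [moyalConj]

lemma moyalRefl_apply (f : SchwartzMap ℝ ℂ) (x : ℝ) :
    moyalRefl f x = f (-x) := by simp [moyalRefl]

noncomputable def moyalConv (f g : SchwartzMap ℝ ℂ) : SchwartzMap ℝ ℂ :=
  SchwartzMap.convolution (ContinuousLinearMap.mul ℂ ℂ) f g

lemma moyalConv_apply (f g : SchwartzMap ℝ ℂ) (x : ℝ) :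
    moyalConv f g x = ∫ t, f t * g (x - t) := by
  simp [moyalConv, SchwartzMap.convolution_apply, convolution_def]

lemma wigner_eq (h : ℝ) (hh : 0 < h) (ψ : ℝ → ℂ) (q p : ℝ) :
    wigner h ψ q p = (1 / (Real.pi * h) : ℝ) *
      ∫ x, (starRingEnd ℂ) (ψ x) * ψ (2 * q - x) * 
        Complex.exp (Complex.I * (p * (2 * (x - q) / h) : ℝ)) := by
  set F : ℝ → ℂ := fun x => (starRingEnd ℂ) (ψ x) * ψ (2 * q - x) * 
        Complex.exp (Complex.I * (p * (2 * (x - q) / h) : ℝ)) with hF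
  have h1 : ∫ s, F (q + (h / 2) * s) = (2 / h : ℝ) * ∫ x, F x := by
    rw [Measure.integral_comp_mul_left (fun x => F (q + x)), integral_add_left_eq_self F q,
      abs_of_pos (by positivity), inv_div, Complex.real_smul]
  have h2 : ∀ s : ℝ, F (q + (h / 2) * s) = (starRingEnd ℂ) (ψ (q + h * s / 2)) *
      ψ (q - h * s / 2) * Complex.exp (Complex.I * (p : ℂ) * (s : ℂ)) := by
    intro s
    simp only [hF]
    rw [show q + h / 2 * s = q + h * s / 2 by ring,
      show 2 * q - (q + h * s / 2) = q - h * s / 2 by ring,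
      show p * (2 * (q + h * s / 2 - q) / h) = p * s by field_simp; ring]
    push_cast
    rw [mul_assoc Complex.I]
  simp only [h2] at h1
  rw [wigner, h1]
  have := Real.pi_pos.ne'
  rw [← mul_assoc]
  congr 1
  push_cast
  have : (Real.pi : ℂ) ≠ 0 := by exact_mod_cast this
  have : (h : ℂ) ≠ 0 := by exact_mod_cast hh.ne'
  field_simp

lemma wigner_eq' (h : ℝ) (hh : 0 < h) (ψ : ℝ → ℂ) (q p : ℝ) :
    wigner h ψ q p = (1 / (Real.pi * h) : ℝ) *
      ∫ z, ψ z * (starRingEnd ℂ) (ψ (2 * q - z)) * 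
        Complex.exp (Complex.I * (p * (2 * (q - z) / h) : ℝ)) := by
  rw [wigner_eq h hh, ← integral_sub_left_eq_self _ volume (2 * q)]
  congr 2; ext z
  rw [show 2 * q - (2 * q - z) = z by ring, show 2 * q - z - q = q - z by ring]
  ring

lemma moyal_inner (h : ℝ) (hh : 0 < h) (ψ φ : SchwartzMap ℝ ℂ) (p : ℝ) :
    ∫ q, wigner h ψ q p * wigner h φ q p = ((1 / (Real.pi * h)) ^ 2 / 2 : ℝ) *
      ∫ v : ℝ, Complex.exp (Complex.I * (p * v * 2 / h : ℝ)) *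
        (moyalConv (moyalConj ψ) (moyalRefl φ) v * moyalConv (moyalRefl ψ) (moyalConj φ) v) := by
  set e : ℝ → ℂ := fun x => Complex.exp (Complex.I * (p * x * 2 / h : ℝ)) with he
  have hec : Continuous e := by rw [he]; fun_prop
  have hen : ∀ x, ‖e x‖ = 1 := fun x => by
    simp only [he]; rw [mul_comm]; exact Complex.norm_exp_ofReal_mul_I _
  have hem : ∀ x y, e (x + y) = e x * e y := fun x y => by
    simp only [he]; rw [← Complex.exp_add]; congr 1; push_cast; ring
  set a : ℝ → ℂ := fun x => moyalConj ψ x * e x with ha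
  set d : ℝ → ℂ := fun x => φ x * e (-x) with hd
  set G : ℝ → ℂ := fun r => (∫ x, a x * ψ (r - x)) * (∫ z, d z * moyalConj φ (r - z)) with hG
  have hai : Integrable a := by
    refine (moyalConj ψ).integrable.norm.mono' (by
      apply Continuous.aestronglyMeasurable; have := (moyalConj ψ).continuous; fun_prop) ?_
    exact Filter.Eventually.of_forall fun x => by simp [ha, hen]
  have hdi : Integrable d := by
    refine φ.integrable.norm.mono' (by
      apply Continuous.aestronglyMeasurable; have := φ.continuous; fun_prop) ?_
    exact Filter.Eventually.of_forall fun x => by simp [hd, hen]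
  have hac : Continuous a := by have := (moyalConj ψ).continuous; fun_prop
  have hdc : Continuous d := by have := φ.continuous; fun_prop
  have h1 : ∀ q, wigner h ψ q p * wigner h φ q p = ((1 / (Real.pi * h)) ^ 2 : ℝ) * G (2 * q) := by
    intro q
    have e1 : ∫ x, (starRingEnd ℂ) (ψ x) * ψ (2 * q - x) * 
        Complex.exp (Complex.I * (p * (2 * (x - q) / h) : ℝ)) =
        e (-q) * ∫ x, a x * ψ (2 * q - x) := by
      rw [← integral_const_mul]
      congr 1; ext x
      have : Complex.exp (Complex.I * (p * (2 * (x - q) / h) : ℝ)) = e (-q) * e x := by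
        rw [← hem]; simp only [he]; congr 3; ring
      rw [this]; simp only [ha, moyalConj_apply]; ring
    have e2 : ∫ z, φ z * (starRingEnd ℂ) (φ (2 * q - z)) * 
        Complex.exp (Complex.I * (p * (2 * (q - z) / h) : ℝ)) =
        e q * ∫ z, d z * moyalConj φ (2 * q - z) := by
      rw [← integral_const_mul]
      congr 1; ext x
      have : Complex.exp (Complex.I * (p * (2 * (q - x) / h) : ℝ)) = e q * e (-x) := by
        rw [← hem]; simp only [he]; congr 3; ring
      rw [this]; simp only [hd, moyalConj_apply]; ring
    have e3 : e (-q) * e q = 1 := by rw [← hem]; simp [he]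
    rw [wigner_eq h hh, wigner_eq' h hh, e1, e2]
    simp only [hG]
    push_cast
    linear_combination ((1 / (Real.pi * h) : ℂ)) ^ 2 * ((∫ x, a x * ψ (2 * q - x)) *
      (∫ z, d z * moyalConj φ (2 * q - z))) * e3
  simp only [h1]
  rw [integral_const_mul, Measure.integral_comp_mul_left G]
  have hf := moyal_fubini a ψ d (moyalConj φ) (moyalConv (moyalRefl ψ) (moyalConj φ))
    hai ψ.integrable hdi hac ψ.continuous hdc (moyalConj φ).continuous
    _ (fun x => SchwartzMap.norm_le_seminorm ℝ (moyalConj φ) x)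
    (SchwartzMap.continuous _) _ (fun x => SchwartzMap.norm_le_seminorm ℝ _ x) (by
      intro v
      rw [moyalConv_apply, ← integral_neg_eq_self]
      congr 1; ext y
      rw [moyalRefl_apply, neg_neg, sub_neg_eq_add, add_comm v])
  rw [show ∫ r, G r = _ from hf]
  have h4 : ∀ v, ∫ x, a x * d (x - v) = e v * moyalConv (moyalConj ψ) (moyalRefl φ) v := by
    intro v
    rw [moyalConv_apply, ← integral_const_mul]
    congr 1; ext x
    have : e v = e x * e (-(x - v)) := by rw [← hem]; congr 1; ring
    rw [this, moyalRefl_apply, neg_sub]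
    simp only [ha, hd, neg_sub]
    ring
  simp only [h4, mul_assoc]
  rw [Complex.real_smul, ← mul_assoc]
  congr 1
  · rw [abs_of_pos (by norm_num)]
    push_cast
    ring
  · simp only [he, mul_assoc]

/-- Moyal overlap formula: for `ℏ > 0` and Schwartz functions `ψ, φ`,
`|∫ conj(ψ(x)) φ(x) dx|² = 2πℏ ∫∫ W_ψ(q,p) W_φ(q,p) dq dp`. -/
theorem stmt_17 (ℏ : ℝ) (hℏ : 0 < ℏ) (ψ φ : SchwartzMap ℝ ℂ) :
    ((‖∫ x : ℝ, (starRingEnd ℂ) (ψ x) * φ x‖ ^ 2 : ℝ) : ℂ)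
      = ((2 * Real.pi * ℏ : ℝ) : ℂ) *
          ∫ p : ℝ, ∫ q : ℝ, wigner ℏ ψ q p * wigner ℏ φ q p := by
  simp only [moyal_inner ℏ hℏ]
  rw [integral_const_mul]
  set A := moyalConv (moyalConj ψ) (moyalRefl φ) with hA
  set B := moyalConv (moyalRefl ψ) (moyalConj φ) with hB
  have key := moyal_inv' (SchwartzMap.pairing (ContinuousLinearMap.mul ℂ ℂ) A B) ℏ hℏ
  simp only [SchwartzMap.pairing_apply_apply, ContinuousLinearMap.mul_apply'] at key
  rw [key]
  have hA0 : A 0 = ∫ x : ℝ, (starRingEnd ℂ) (ψ x) * φ x := by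
    rw [hA, moyalConv_apply]
    simp [moyalRefl_apply, moyalConj_apply]
  have hB0 : B 0 = (starRingEnd ℂ) (∫ x : ℝ, (starRingEnd ℂ) (ψ x) * φ x) := by
    rw [hB, moyalConv_apply, ← integral_neg_eq_self, ← integral_conj]
    simp [moyalRefl_apply, moyalConj_apply]
  rw [hA0, hB0, Complex.mul_conj, Complex.normSq_eq_norm_sq]
  have := Real.pi_pos.ne'
  have := hℏ.ne'
  norm_cast
  field_simp
end
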